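/- arXiv:1201.2722 — 2 statements merged into one kernel-verified Lean document; each statement's English description precedes it below -/
import Mathlib

section
/- The Whitten group Γ₂ has exactly 27 subgroups up to conjugacy; that is, the equivalence relation on the set of subgroups of Γ₂ given by conjugation by elements of Γ₂ has exactly 27 equivalence classes. -/
/-- The homomorphism `ω : S_μ → Aut(Z₂^{μ+1})`: a permutation `p` fixes the 0th
coordinate (indexed by `none`) and permutes the remaining `μ` coordinates
(indexed by `some i`). -/
def whittenHom (μ : ℕ) :
    Equiv.Perm (Fin μ) →* MulAut (Option (Fin μ) → Multiplicative (ZMod 2)) where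
  toFun p := MulEquiv.arrowCongr (Equiv.optionCongr p) (MulEquiv.refl _)
  map_one' := by
    ext f x
    cases x <;> rfl
  map_mul' := by
    intro p q
    ext f x
    cases x <;> rfl

/-- The Whitten group `Γ_μ = Z₂^{μ+1} ⋊_ω S_μ`. -/
abbrev WhittenGroup (μ : ℕ) : Type :=
  (Option (Fin μ) → Multiplicative (ZMod 2)) ⋊[whittenHom μ] Equiv.Perm (Fin μ)

/-- Two subgroups are conjugate if one is carried to the other by conjugation. -/
def subgroupConj {G : Type*} [Group G] (H K : Subgroup G) : Prop :=
  ∃ γ : G, Subgroup.map (MulAut.conj γ).toMonoidHom H = K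

theorem subgroupConj_equivalence {G : Type*} [Group G] :
    Equivalence (subgroupConj (G := G)) where
  refl H := ⟨1, by ext; simp⟩
  symm := by
    rintro H _ ⟨γ, rfl⟩
    refine ⟨γ⁻¹, ?_⟩
    ext x
    simp [mul_assoc]
  trans := by
    rintro H _ _ ⟨γ, rfl⟩ ⟨δ, rfl⟩
    refine ⟨δ * γ, ?_⟩
    rw [Subgroup.map_map]
    congr 1
    ext x
    simp

/-- A finite family of subgroups starting from the trivial one meets every conjugacy class as soon
as adjoining an outside element to a member of the family yields a subgroup containing a conjugate
of a later member. -/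
theorem exists_subgroupConj_of_extend {G ι : Type*} [Group G] [Finite ι] [LinearOrder ι]
    (R : ι → Subgroup G) {i₀ : ι} (h₀ : R i₀ = ⊥)
    (hext : ∀ i, ∀ g ∉ R i, ∃ j > i, ∃ δ : G,
      (R j).map (MulAut.conj δ).toMonoidHom ≤ R i ⊔ Subgroup.zpowers g)
    (H : Subgroup G) : ∃ i, subgroupConj (R i) H := by
  obtain ⟨i, ⟨γ, hγ⟩, hmax⟩ :=
    (Set.toFinite {i | ∃ γ : G, (R i).map (MulAut.conj γ).toMonoidHom ≤ H}).exists_maximal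
      ⟨i₀, 1, by simp [h₀]⟩
  refine ⟨i, γ, le_antisymm hγ fun x hx => ?_⟩
  by_contra hxR
  obtain ⟨j, hij, δ, hδ⟩ := hext i (γ⁻¹ * x * γ) fun hmem =>
    hxR ⟨_, hmem, by simp [mul_assoc]⟩
  refine hij.not_ge (hmax ⟨γ * δ, ?_⟩ hij.le)
  have hle : R i ⊔ Subgroup.zpowers (γ⁻¹ * x * γ) ≤
      H.comap (MulAut.conj γ).toMonoidHom := by
    rw [sup_le_iff, Subgroup.zpowers_le]
    exact ⟨Subgroup.map_le_iff_le_comap.1 hγ, by simpa [mul_assoc] using hx⟩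
  rintro _ ⟨y, hy, rfl⟩
  simpa [mul_assoc] using hle (hδ ⟨y, hy, rfl⟩)

namespace WhittenGroup

/-- Exchange the bits of weight `2` and `4`. -/
def swapBits (n : ℕ) : ℕ := (n &&& 9) ||| ((n &&& 2) <<< 1) ||| ((n &&& 4) >>> 1)

/-- The multiplication of `Γ₂` in binary coordinates, on numbers below `16`: the bits of weight
`1`, `2`, `4` give the `Z₂³` component and the bit of weight `8` the permutation. -/
def codeMul (a b : ℕ) : ℕ := a ^^^ bif a.testBit 3 then swapBits b else b

/-- The inverse of `Γ₂` in binary coordinates. -/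
def codeInv (a : ℕ) : ℕ := bif a.testBit 3 then swapBits a else a

/-- Conjugation of `a` by `d` in binary coordinates. -/
def codeConj (d a : ℕ) : ℕ := codeMul (codeMul d a) (codeInv d)

theorem codeMul_lt : ∀ a < 16, ∀ b < 16, codeMul a b < 16 := by
  decide +kernel

theorem codeInv_lt : ∀ a < 16, codeInv a < 16 := by
  decide +kernel

theorem codeConj_lt {d a : ℕ} (hd : d < 16) (ha : a < 16) : codeConj d a < 16 :=
  codeMul_lt _ (codeMul_lt _ hd _ ha) _ (codeInv_lt _ hd)

/-- The element of `Γ₂` with given binary coordinates. -/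
def decode (a : ℕ) : WhittenGroup 2 :=
  ⟨fun o => Multiplicative.ofAdd (if a.testBit (o.elim 0 (·.val + 1)) then 1 else 0),
    if a.testBit 3 then Equiv.swap 0 1 else 1⟩

theorem decode_mul : ∀ a < 16, ∀ b < 16, decode (codeMul a b) = decode a * decode b := by
  simp only [SemidirectProduct.ext_iff]
  decide +kernel

theorem decode_zero : decode 0 = 1 := by
  rw [SemidirectProduct.ext_iff]
  decide +kernel

theorem decode_inv (a : ℕ) (ha : a < 16) : decode (codeInv a) = (decode a)⁻¹ := by
  have h : ∀ a < 16, codeMul a (codeInv a) = 0 := by decide +kernel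
  exact eq_inv_of_mul_eq_one_right
    (by rw [← decode_mul a ha _ (codeInv_lt a ha), h a ha, decode_zero])

theorem decode_codeConj {d a : ℕ} (hd : d < 16) (ha : a < 16) :
    decode (codeConj d a) = MulAut.conj (decode d) (decode a) := by
  rw [codeConj, decode_mul _ (codeMul_lt d hd a ha) _ (codeInv_lt d hd), decode_mul d hd a ha,
    decode_inv d hd, MulAut.conj_apply]

theorem decode_injOn : ∀ a < 16, ∀ b < 16, decode a = decode b → a = b := by
  simp only [SemidirectProduct.ext_iff]
  decide +kernel

theorem exists_decode_eq (x : WhittenGroup 2) : ∃ a < 16, decode a = x := by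
  have h : ∀ (f : Option (Fin 2) → Multiplicative (ZMod 2)) (p : Equiv.Perm (Fin 2)),
      ∃ a < 16, (decode a).left = f ∧ (decode a).right = p := by
    decide +kernel
  obtain ⟨a, ha, hx⟩ := h x.left x.right
  exact ⟨a, ha, SemidirectProduct.ext_iff.2 hx⟩

/-- Bitmasks, in binary coordinates, of representatives of the conjugacy classes of subgroups. -/
def masks : List ℕ :=
  [1, 3, 5, 9, 65, 129, 257, 513, 15, 85, 105, 153, 195, 771, 5185, 10305, 16705, 17025, 33345,
    255, 15555, 21845, 26985, 38505, 43605, 50115, 65535]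

/-- Membership in the `k`-th representative. -/
def inMask (k a : ℕ) : Bool := (masks.getD k 0).testBit a

theorem inMask_zero : ∀ k < 27, inMask k 0 := by
  decide +kernel

theorem inMask_codeMul : ∀ k < 27, ∀ a < 16, inMask k a → ∀ b < 16, inMask k b →
    inMask k (codeMul a b) := by
  decide +kernel

theorem inMask_codeInv : ∀ k < 27, ∀ a < 16, inMask k a → inMask k (codeInv a) := by
  decide +kernel

theorem exists_inMask_ne_codeConj : ∀ k < 27, ∀ l < k, ∀ d < 16,
    ∃ a < 16, inMask k a ≠ inMask l (codeConj d a) := by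
  decide +kernel

set_option synthInstance.maxSize 1000 in
theorem exists_extension : ∀ k < 27, ∀ g < 16, ¬ inMask k g →
    ∃ l < 27, k < l ∧ ∃ d ∈ [0, 10], ∀ a < 16, inMask l a →
      inMask k (codeConj d a) ∨ ∃ b < 16, inMask k b ∧
        (inMask k (codeMul (codeMul g b) (codeConj d a)) ∨
          inMask k (codeMul (codeMul (codeMul g b) (codeConj d a)) g)) := by
  decide +kernel

/-- The `k`-th representative. -/
def rep (k : Fin 27) : Subgroup (WhittenGroup 2) where
  carrier := {x | ∃ a < 16, inMask k a ∧ decode a = x}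
  one_mem' := ⟨0, by simp, inMask_zero k k.isLt, decode_zero⟩
  mul_mem' := by
    rintro _ _ ⟨a, ha, hka, rfl⟩ ⟨b, hb, hkb, rfl⟩
    exact ⟨_, codeMul_lt a ha b hb, inMask_codeMul k k.isLt a ha hka b hb hkb,
      decode_mul a ha b hb⟩
  inv_mem' := by
    rintro _ ⟨a, ha, hka, rfl⟩
    exact ⟨_, codeInv_lt a ha, inMask_codeInv k k.isLt a ha hka, decode_inv a ha⟩

theorem decode_mem_rep {k : Fin 27} {a : ℕ} (ha : a < 16) : decode a ∈ rep k ↔ inMask k a := by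
  refine ⟨?_, fun h => ⟨a, ha, h, rfl⟩⟩
  rintro ⟨b, hb, hkb, hab⟩
  rwa [← decode_injOn b hb a ha hab]

theorem rep_extend (k : Fin 27) (x : WhittenGroup 2) (hx : x ∉ rep k) :
    ∃ l > k, ∃ δ, (rep l).map (MulAut.conj δ).toMonoidHom ≤ rep k ⊔ Subgroup.zpowers x := by
  obtain ⟨g, hg, rfl⟩ := exists_decode_eq x
  obtain ⟨l, hl, hkl, d, hd, h⟩ :=
    exists_extension k k.isLt g hg (by rwa [decode_mem_rep hg] at hx)
  replace hd : d < 16 := by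
    simp only [List.mem_cons, List.not_mem_nil, or_false] at hd
    omega
  refine ⟨⟨l, hl⟩, hkl, decode d, ?_⟩
  rintro _ ⟨_, ⟨a, ha, hla, rfl⟩, rfl⟩
  change MulAut.conj (decode d) (decode a) ∈ _
  rw [← decode_codeConj hd ha]
  have hc := codeConj_lt hd ha
  have hk : rep k ≤ rep k ⊔ Subgroup.zpowers (decode g) := le_sup_left
  have hgmem : decode g ∈ rep k ⊔ Subgroup.zpowers (decode g) :=
    Subgroup.mem_sup_right (Subgroup.mem_zpowers _)
  obtain h | ⟨b, hb, hkb, h⟩ := h a ha hla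
  · exact hk ((decode_mem_rep hc).2 h)
  have hgb := codeMul_lt g hg b hb
  have hgbmem : decode (codeMul g b) ∈ rep k ⊔ Subgroup.zpowers (decode g) := by
    rw [decode_mul g hg b hb]
    exact mul_mem hgmem (hk ((decode_mem_rep hb).2 hkb))
  have hgbc := codeMul_lt _ hgb _ hc
  rw [← Subgroup.mul_mem_cancel_left _ hgbmem, ← decode_mul _ hgb _ hc]
  obtain h | h := h
  · exact hk ((decode_mem_rep hgbc).2 h)
  · rw [← Subgroup.mul_mem_cancel_right _ hgmem, ← decode_mul _ hgbc _ hg]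
    exact hk ((decode_mem_rep (codeMul_lt _ hgbc _ hg)).2 h)

theorem rep_zero : rep 0 = ⊥ := by
  have h : ∀ a < 16, inMask 0 a → a = 0 := by decide +kernel
  rw [eq_bot_iff]
  rintro _ ⟨a, ha, h0a, rfl⟩
  rw [h a ha h0a, decode_zero]
  exact one_mem _

theorem not_subgroupConj_rep {k l : Fin 27} (hlk : l < k) : ¬ subgroupConj (rep k) (rep l) := by
  rintro ⟨γ, hγ⟩
  obtain ⟨d, hd, rfl⟩ := exists_decode_eq γ
  obtain ⟨a, ha, hne⟩ := exists_inMask_ne_codeConj k k.isLt l hlk d hd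
  refine hne (Bool.eq_iff_iff.2 ?_)
  rw [← decode_mem_rep ha, ← decode_mem_rep (codeConj_lt hd ha), ← hγ, decode_codeConj hd ha]
  exact (Subgroup.mem_map_iff_mem (MulAut.conj (decode d)).injective).symm

theorem eq_of_subgroupConj_rep {k l : Fin 27} (h : subgroupConj (rep k) (rep l)) : k = l :=
  le_antisymm (not_lt.1 fun hlk => not_subgroupConj_rep hlk h)
    (not_lt.1 fun hkl => not_subgroupConj_rep hkl (subgroupConj_equivalence.symm h))

end WhittenGroup

/-- The Whitten group Γ₂ has exactly 27 subgroups up to conjugacy: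
the conjugation relation on subgroups of Γ₂ has exactly 27 equivalence classes. -/
theorem whittenGroup_two_num_subgroups_up_to_conj :
    Nat.card (Quot (subgroupConj (G := WhittenGroup 2))) = 27 := by
  have hbij : Function.Bijective
      fun k : Fin 27 => Quot.mk (subgroupConj (G := WhittenGroup 2)) (WhittenGroup.rep k) := by
    refine ⟨fun k l h => WhittenGroup.eq_of_subgroupConj_rep
      ((subgroupConj_equivalence.quot_mk_eq_iff _ _).1 h), ?_⟩
    rintro ⟨H⟩
    obtain ⟨k, hk⟩ := exists_subgroupConj_of_extend WhittenGroup.rep WhittenGroup.rep_zero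
      WhittenGroup.rep_extend H
    exact ⟨k, Quot.sound hk⟩
  rw [← Nat.card_eq_of_bijective _ hbij, Nat.card_fin]
end

section
/- The Whitten group Γ₂ has exactly 19 normal subgroups; equivalently, exactly 8 conjugacy classes of subgroups of Γ₂ contain two subgroups each (8 conjugate pairs), and the remaining 19 conjugacy classes each contain a single subgroup. -/
/-- Exchange the bits of weight `2` and `4` in a four-bit number. -/
def swapBits (b : ℕ) : ℕ := (b &&& 9) ||| ((b &&& 2) <<< 1) ||| ((b &&& 4) >>> 1)

/-- The multiplication of `WhittenGroup 2` on four-bit codes. -/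
def codeMul (a b : ℕ) : ℕ := a ^^^ (if a.testBit 3 then swapBits b else b)

/-- The inverse of `WhittenGroup 2` on four-bit codes; the exponent of the group is `4`. -/
def codeInv (a : ℕ) : ℕ := codeMul a (codeMul a a)

/-- An element of `WhittenGroup 2` as a four-bit number: three bits for the vector, one for the
permutation. -/
def whittenCode (g : WhittenGroup 2) : ℕ :=
  (g.left none).toAdd.val + 2 * (g.left (some 0)).toAdd.val + 4 * (g.left (some 1)).toAdd.val
    + 8 * (g.right 0).val

theorem whittenCode_lt (g : WhittenGroup 2) : whittenCode g < 16 := by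
  have h₀ := ZMod.val_lt (g.left none).toAdd
  have h₁ := ZMod.val_lt (g.left (some 0)).toAdd
  have h₂ := ZMod.val_lt (g.left (some 1)).toAdd
  have h₃ := (g.right 0).isLt
  unfold whittenCode
  lia

theorem whittenCode_injective : Function.Injective whittenCode := by
  have key : ∀ p q : Equiv.Perm (Fin 2), p 0 = q 0 → p = q := by decide
  intro g h hgh
  have h₀ := ZMod.val_lt (g.left none).toAdd
  have h₁ := ZMod.val_lt (g.left (some 0)).toAdd
  have h₂ := ZMod.val_lt (g.left (some 1)).toAdd
  have k₀ := ZMod.val_lt (h.left none).toAdd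
  have k₁ := ZMod.val_lt (h.left (some 0)).toAdd
  have k₂ := ZMod.val_lt (h.left (some 1)).toAdd
  unfold whittenCode at hgh
  have e : (g.left none).toAdd.val = (h.left none).toAdd.val ∧
      (g.left (some 0)).toAdd.val = (h.left (some 0)).toAdd.val ∧
      (g.left (some 1)).toAdd.val = (h.left (some 1)).toAdd.val ∧
      (g.right 0).val = (h.right 0).val := by lia
  ext x
  · apply Multiplicative.toAdd.injective
    apply ZMod.val_injective 2
    match x with
    | none => exact e.1
    | some 0 => exact e.2.1
    | some 1 => exact e.2.2.1
  · rw [key g.right h.right (Fin.ext e.2.2.2)]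

theorem whittenCode_one : whittenCode 1 = 0 := by decide

theorem whittenCode_mul (g h : WhittenGroup 2) :
    whittenCode (g * h) = codeMul (whittenCode g) (whittenCode h) := by
  have key : ∀ (a b c d e f : ZMod 2) (p q : Equiv.Perm (Fin 2)),
      (a + d).val + 2 * (b + if p 0 = 0 then e else f).val
        + 4 * (c + if p 0 = 0 then f else e).val + 8 * (p (q 0)).val
      = codeMul (a.val + 2 * b.val + 4 * c.val + 8 * (p 0).val)
          (d.val + 2 * e.val + 4 * f.val + 8 * (q 0).val) := by decide +kernel
  have perm : ∀ p : Equiv.Perm (Fin 2), p.symm 0 = (if p 0 = 0 then 0 else 1) ∧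
      p.symm 1 = (if p 0 = 0 then 1 else 0) := by decide
  have hp := perm g.right
  have := key (g.left none).toAdd (g.left (some 0)).toAdd (g.left (some 1)).toAdd
    (h.left none).toAdd (h.left (some 0)).toAdd (h.left (some 1)).toAdd g.right h.right
  unfold whittenCode
  rw [← this]
  have e₀ : whittenHom 2 g.right h.left none = h.left none := rfl
  have e₁ : whittenHom 2 g.right h.left (some 0) = h.left (some (g.right.symm 0)) := rfl
  have e₂ : whittenHom 2 g.right h.left (some 1) = h.left (some (g.right.symm 1)) := rfl
  simp only [SemidirectProduct.mul_left, SemidirectProduct.mul_right, Pi.mul_apply, e₀, e₁, e₂,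
    hp.1, hp.2, Equiv.Perm.mul_apply, toAdd_mul]
  split_ifs <;> rfl

theorem whittenCode_inv (g : WhittenGroup 2) :
    whittenCode g⁻¹ = codeInv (whittenCode g) := by
  have key : ∀ i < 16, codeMul i (codeInv i) = 0 := by decide
  have : g⁻¹ = g * (g * g) := by
    rw [inv_eq_iff_mul_eq_one]
    apply whittenCode_injective
    rw [whittenCode_one, whittenCode_mul, whittenCode_mul, whittenCode_mul]
    exact key _ (whittenCode_lt g)
  rw [this, whittenCode_mul, whittenCode_mul, codeInv]

theorem exists_whittenCode_eq {i : ℕ} (hi : i < 16) : ∃ g, whittenCode g = i := by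
  have key : ∀ i < 16, ∃ (a : Option (Fin 2) → Multiplicative (ZMod 2))
      (p : Equiv.Perm (Fin 2)), whittenCode ⟨a, p⟩ = i := by
    decide +kernel
  obtain ⟨a, p, h⟩ := key i hi
  exact ⟨_, h⟩

/-- Whether the set of codes given by the binary digits of `m` is closed under multiplication and
contains the identity. -/
def isSubgroupMask (m : ℕ) : Bool :=
  m.testBit 0 && (List.range 16).all fun i => !m.testBit i ||
    (List.range 16).all fun j => !m.testBit j || m.testBit (codeMul i j)

/-- Whether the set of codes given by the binary digits of `m` is closed under conjugation. -/
def isNormalMask (m : ℕ) : Bool :=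
  (List.range 16).all fun i => !m.testBit i ||
    (List.range 16).all fun j => m.testBit (codeMul (codeMul j i) (codeInv j))

/-- The digit masks of the subgroups of `WhittenGroup 2`. -/
def subgroupMasks : List ℕ :=
  [1, 257, 513, 16385, 32769, 3, 771, 49155, 5, 9, 15, 17, 33, 51, 65, 5185, 10305,
    16705, 33345, 85, 21845, 43605, 105, 26985, 38505, 129, 17025, 33153, 153, 165, 195,
    15555, 50115, 255, 65535]

theorem filter_isSubgroupMask_eq :
    (((List.range 256).filter isSubgroupMask).flatMap fun a =>
      ((List.range 256).map (a + 256 * ·)).filter isSubgroupMask) = subgroupMasks := by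
  decide +kernel

theorem isSubgroupMask_iff {m : ℕ} : isSubgroupMask m ↔ m.testBit 0 ∧
    ∀ i < 16, m.testBit i → ∀ j < 16, m.testBit j → m.testBit (codeMul i j) := by
  simp only [isSubgroupMask, Bool.and_eq_true, List.all_eq_true, List.mem_range, Bool.or_eq_true,
    Bool.not_eq_true', ← Bool.not_eq_true, ← imp_iff_not_or]

theorem isNormalMask_iff {m : ℕ} : isNormalMask m ↔
    ∀ i < 16, m.testBit i → ∀ j < 16, m.testBit (codeMul (codeMul j i) (codeInv j)) := by
  simp only [isNormalMask, List.all_eq_true, List.mem_range, Bool.or_eq_true,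
    Bool.not_eq_true', ← Bool.not_eq_true, ← imp_iff_not_or]

theorem mem_subgroupMasks_iff {m : ℕ} :
    m ∈ subgroupMasks ↔ m < 2 ^ 16 ∧ isSubgroupMask m := by
  rw [← filter_isSubgroupMask_eq]
  simp only [List.mem_flatMap, List.mem_filter, List.mem_map, List.mem_range]
  constructor
  · rintro ⟨a, ⟨ha, -⟩, ⟨b, hb, rfl⟩, h⟩
    exact ⟨by lia, h⟩
  · rintro ⟨hm, h⟩
    refine ⟨m % 256, ⟨Nat.mod_lt _ (by lia), ?_⟩, ⟨m / 256, by lia, by lia⟩, h⟩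
    rw [isSubgroupMask_iff] at h ⊢
    have key : ∀ i < 8, ∀ j < 8, codeMul i j < 8 := by decide
    simp only [show 256 = 2 ^ 8 from rfl, Nat.testBit_mod_two_pow, Bool.and_eq_true,
      decide_eq_true_eq]
    exact ⟨⟨by lia, h.1⟩, fun i hi hi' j hj hj' =>
      ⟨key i hi'.1 j hj'.1, h.2 i hi hi'.2 j hj hj'.2⟩⟩

/-- The subgroup of `WhittenGroup 2` with a given digit mask. -/
def subgroupOfMask (m : ℕ) (hm : m ∈ subgroupMasks) : Subgroup (WhittenGroup 2) where
  carrier := {g | m.testBit (whittenCode g)}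
  one_mem' := by
    have := (isSubgroupMask_iff.1 (mem_subgroupMasks_iff.1 hm).2).1
    rwa [Set.mem_ofPred_eq, whittenCode_one]
  mul_mem' {a b} ha hb := by
    have := (isSubgroupMask_iff.1 (mem_subgroupMasks_iff.1 hm).2).2
    rw [Set.mem_ofPred_eq] at *
    rw [whittenCode_mul]
    exact this _ (whittenCode_lt a) ha _ (whittenCode_lt b) hb
  inv_mem' {a} ha := by
    have := (isSubgroupMask_iff.1 (mem_subgroupMasks_iff.1 hm).2).2
    rw [Set.mem_ofPred_eq] at *
    rw [whittenCode_inv, codeInv, ← whittenCode_mul]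
    refine this _ (whittenCode_lt a) ha _ (whittenCode_lt _) ?_
    rw [whittenCode_mul]
    exact this _ (whittenCode_lt a) ha _ (whittenCode_lt a) ha

theorem mem_subgroupOfMask {m : ℕ} {hm : m ∈ subgroupMasks} {g : WhittenGroup 2} :
    g ∈ subgroupOfMask m hm ↔ m.testBit (whittenCode g) := Iff.rfl

theorem subgroupOfMask_bijective :
    Function.Bijective fun m : {m // m ∈ subgroupMasks} => subgroupOfMask m.1 m.2 := by
  constructor
  · rintro ⟨m, hm⟩ ⟨n, hn⟩ h
    apply Subtype.ext
    have hm' := (mem_subgroupMasks_iff.1 hm).1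
    have hn' := (mem_subgroupMasks_iff.1 hn).1
    apply Nat.eq_of_testBit_eq
    intro i
    rcases lt_or_ge i 16 with hi | hi
    · obtain ⟨g, rfl⟩ := exists_whittenCode_eq hi
      rw [Bool.eq_iff_iff, ← mem_subgroupOfMask (hm := hm), ← mem_subgroupOfMask (hm := hn)]
      exact SetLike.ext_iff.1 h g
    · have := Nat.pow_le_pow_right (show 0 < 2 by lia) hi
      rw [Nat.testBit_lt_two_pow (hm'.trans_le this), Nat.testBit_lt_two_pow (hn'.trans_le this)]
  · intro H
    classical
    let f : Fin 16 → Bool := fun i => decide (∃ g ∈ H, whittenCode g = i)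
    have hf (g : WhittenGroup 2) : (Nat.ofBits f).testBit (whittenCode g) ↔ g ∈ H := by
      rw [Nat.testBit_ofBits_lt _ _ (whittenCode_lt g), decide_eq_true_eq]
      constructor
      · rintro ⟨g', hg', h⟩
        rwa [← whittenCode_injective h]
      · exact fun h => ⟨g, h, rfl⟩
    have hm : Nat.ofBits f ∈ subgroupMasks := by
      refine mem_subgroupMasks_iff.2 ⟨Nat.ofBits_lt_two_pow f, isSubgroupMask_iff.2 ⟨?_, ?_⟩⟩
      · rw [← whittenCode_one, hf]
        exact H.one_mem
      · intro i hi hi' j hj hj'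
        obtain ⟨g, rfl⟩ := exists_whittenCode_eq hi
        obtain ⟨h, rfl⟩ := exists_whittenCode_eq hj
        rw [hf] at hi' hj'
        rw [← whittenCode_mul, hf]
        exact H.mul_mem hi' hj'
    exact ⟨⟨_, hm⟩, SetLike.ext fun g => mem_subgroupOfMask.trans (hf g)⟩

theorem normal_subgroupOfMask_iff {m : ℕ} (hm : m ∈ subgroupMasks) :
    (subgroupOfMask m hm).Normal ↔ isNormalMask m := by
  rw [isNormalMask_iff]
  constructor
  · intro h i hi hi' j hj
    obtain ⟨g, rfl⟩ := exists_whittenCode_eq hi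
    obtain ⟨k, rfl⟩ := exists_whittenCode_eq hj
    rw [← whittenCode_inv, ← whittenCode_mul, ← whittenCode_mul]
    exact h.conj_mem g hi' k
  · refine fun h => ⟨fun g hg k => ?_⟩
    rw [mem_subgroupOfMask, whittenCode_mul, whittenCode_mul, whittenCode_inv]
    exact h _ (whittenCode_lt g) hg _ (whittenCode_lt k)

theorem card_subgroup_whittenGroup_two : Nat.card (Subgroup (WhittenGroup 2)) = 35 := by
  rw [← Nat.card_eq_of_bijective _ subgroupOfMask_bijective,
    Nat.subtype_card subgroupMasks.toFinset (fun _ => List.mem_toFinset)]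
  decide +kernel

theorem card_normal_subgroup_whittenGroup_two :
    Nat.card {H : Subgroup (WhittenGroup 2) // H.Normal} = 19 := by
  have e := Equiv.subtypeEquiv (Equiv.ofBijective _ subgroupOfMask_bijective)
    (q := fun H => H.Normal) (fun m => (normal_subgroupOfMask_iff m.2).symm)
  rw [← Nat.card_congr e,
    Nat.card_congr (Equiv.subtypeSubtypeEquivSubtypeInter (· ∈ subgroupMasks) (isNormalMask ·)),
    Nat.subtype_card (subgroupMasks.toFinset.filter (isNormalMask ·)) (by simp)]
  decide +kernel

/-- Every subgroup has at most one other conjugate, by a fixed element `r`. Here `r` has order `4`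
and its square generates the commutator subgroup. -/
theorem exists_conj_eq_or_conj_eq : ∃ r : WhittenGroup 2, ∀ (H : Subgroup (WhittenGroup 2)) γ,
    H.map (MulAut.conj γ).toMonoidHom = H ∨
      H.map (MulAut.conj γ).toMonoidHom = H.map (MulAut.conj r).toMonoidHom := by
  obtain ⟨r, hr⟩ := exists_whittenCode_eq (show 10 < 16 by lia)
  refine ⟨r, fun H γ => ?_⟩
  have normal : r * r ∈ H → ∀ g h, h ∈ H → g * h * g⁻¹ ∈ H := by
    have key : ∀ i < 16, ∀ j < 16, codeMul (codeMul i j) (codeInv i) = j ∨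
        codeMul (codeMul i j) (codeInv i) = codeMul (codeMul 10 10) j := by decide +kernel
    intro hz g h hh
    have := key _ (whittenCode_lt g) _ (whittenCode_lt h)
    simp only [← hr, ← whittenCode_inv, ← whittenCode_mul, whittenCode_injective.eq_iff] at this
    rcases this with h' | h' <;> rw [h']
    exacts [hh, H.mul_mem hz hh]
  by_cases hz : r * r ∈ H
  · have : H.Normal := ⟨fun h hh g => normal hz g h hh⟩
    exact .inl (Subgroup.Normal.map_conj_eq _ γ)
  have key : ∀ c < 16, ∀ i < 16, ∀ j < 16, codeMul i i = codeMul 10 10 ∨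
      codeMul j j = codeMul 10 10 ∨
      codeMul (codeMul i j) (codeMul i j) = codeMul 10 10 ∨
      codeMul (codeMul c i) (codeInv c) = i ∨
      codeMul (codeMul c j) (codeInv c) = codeMul (codeMul 10 j) (codeInv 10) := by
    decide +kernel
  by_cases hfix : ∀ h ∈ H, γ * h * γ⁻¹ = h
  · left
    ext x
    simp only [Subgroup.mem_map, MulEquiv.coe_toMonoidHom, MulAut.conj_apply]
    constructor
    · rintro ⟨h, hh, rfl⟩
      rwa [hfix h hh]
    · exact fun hx => ⟨x, hx, hfix x hx⟩
  · right
    push Not at hfix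
    obtain ⟨h₀, hh₀, hne⟩ := hfix
    have sq {h : WhittenGroup 2} (hh : h ∈ H) : h * h ≠ r * r := fun e => hz (e ▸ H.mul_mem hh hh)
    have heq (k) (hk : k ∈ H) : γ * k * γ⁻¹ = r * k * r⁻¹ := by
      have := key _ (whittenCode_lt γ) _ (whittenCode_lt h₀) _ (whittenCode_lt k)
      simp only [← hr, ← whittenCode_inv, ← whittenCode_mul, whittenCode_injective.eq_iff] at this
      simpa only [sq hh₀, sq hk, sq (H.mul_mem hh₀ hk), hne, false_or] using this
    ext x
    simp only [Subgroup.mem_map, MulEquiv.coe_toMonoidHom, MulAut.conj_apply]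
    exact exists_congr fun k => and_congr_right fun hk => by rw [heq k hk]

theorem quot_subgroupConj_eq_iff {G : Type*} [Group G] {H K : Subgroup G} :
    Quot.mk subgroupConj H = Quot.mk subgroupConj K ↔ subgroupConj H K :=
  subgroupConj_equivalence.quot_mk_eq_iff H K

theorem card_conjClass_eq_one_iff {G : Type*} [Group G] (H : Subgroup G) :
    Nat.card {K : Subgroup G // Quot.mk subgroupConj K = Quot.mk subgroupConj H} = 1 ↔
      H.Normal := by
  rw [Nat.card_eq_one_iff_unique]
  constructor
  · rintro ⟨h, -⟩
    refine ⟨fun h hh g => ?_⟩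
    have hc : subgroupConj (H.map (MulAut.conj g).toMonoidHom) H :=
      subgroupConj_equivalence.symm ⟨g, rfl⟩
    have := congrArg Subtype.val (Subsingleton.elim
      (⟨_, quot_subgroupConj_eq_iff.2 hc⟩ : {K // Quot.mk subgroupConj K = Quot.mk _ H}) ⟨H, rfl⟩)
    exact SetLike.le_def.1 this.le ⟨h, hh, rfl⟩
  · intro hN
    refine ⟨⟨?_⟩, ⟨H, rfl⟩⟩
    have key (K) (hK : Quot.mk subgroupConj K = Quot.mk subgroupConj H) : K = H := by
      obtain ⟨γ, rfl⟩ := quot_subgroupConj_eq_iff.1 hK.symm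
      exact Subgroup.Normal.map_conj_eq _ γ
    rintro ⟨K, hK⟩ ⟨L, hL⟩
    exact Subtype.ext ((key K hK).trans (key L hL).symm)

/-- Conjugacy classes with one element correspond to normal subgroups. -/
theorem card_singleton_conjClasses (G : Type*) [Group G] :
    Nat.card {q : Quot (subgroupConj (G := G)) //
      Nat.card {H : Subgroup G // Quot.mk subgroupConj H = q} = 1} =
    Nat.card {H : Subgroup G // H.Normal} := by
  symm
  refine Nat.card_eq_of_bijective
    (fun H => ⟨Quot.mk _ H.1, (card_conjClass_eq_one_iff H.1).2 H.2⟩) ⟨?_, ?_⟩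
  · rintro ⟨H, hH⟩ ⟨K, hK⟩ h
    obtain ⟨γ, rfl⟩ := quot_subgroupConj_eq_iff.1 (congrArg Subtype.val h)
    exact Subtype.ext (Subgroup.Normal.map_conj_eq _ γ).symm
  · rintro ⟨q, hq⟩
    induction q using Quot.ind with
    | mk H => exact ⟨⟨H, (card_conjClass_eq_one_iff H).1 hq⟩, rfl⟩

theorem card_conjClass_eq_one_or_two (q : Quot (subgroupConj (G := WhittenGroup 2))) :
    Nat.card {H : Subgroup (WhittenGroup 2) // Quot.mk subgroupConj H = q} = 1 ∨
      Nat.card {H : Subgroup (WhittenGroup 2) // Quot.mk subgroupConj H = q} = 2 := by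
  obtain ⟨r, hr⟩ := exists_conj_eq_or_conj_eq
  induction q using Quot.ind with
  | mk H =>
  have : {K | Quot.mk subgroupConj K = Quot.mk subgroupConj H} =
      {H, H.map (MulAut.conj r).toMonoidHom} := by
    ext K
    rw [Set.mem_ofPred_eq, eq_comm, quot_subgroupConj_eq_iff]
    constructor
    · rintro ⟨γ, rfl⟩
      exact hr H γ
    · rintro (rfl | rfl)
      exacts [subgroupConj_equivalence.refl _, ⟨r, rfl⟩]
  change Set.ncard {K | Quot.mk subgroupConj K = Quot.mk subgroupConj H} = 1 ∨
    Set.ncard {K | Quot.mk subgroupConj K = Quot.mk subgroupConj H} = 2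
  rw [this]
  by_cases h : H = H.map (MulAut.conj r).toMonoidHom
  · left
    rw [← h, Set.pair_eq_singleton, Set.ncard_singleton]
  · exact .inr (Set.ncard_pair h)

theorem Nat.card_eq_add_two_mul_of_card_fiber {α β : Type*} [Finite α] [Finite β] (f : α → β)
    (hf : ∀ b, Nat.card {a // f a = b} = 1 ∨ Nat.card {a // f a = b} = 2) :
    Nat.card α = Nat.card {b // Nat.card {a // f a = b} = 1} +
      2 * Nat.card {b // Nat.card {a // f a = b} = 2} := by
  classical
  have := Fintype.ofFinite β
  rw [← Nat.card_congr (Equiv.sigmaFiberEquiv f), Nat.card_sigma, Nat.card_eq_fintype_card,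
    Nat.card_eq_fintype_card, Fintype.card_subtype, Fintype.card_subtype, Finset.card_filter,
    Finset.card_filter, Finset.mul_sum, ← Finset.sum_add_distrib]
  refine Finset.sum_congr rfl fun b _ => ?_
  rcases hf b with h | h <;> simp [h]

/-- Γ₂ has exactly 19 normal subgroups; equivalently, exactly 8
conjugacy classes of subgroups of Γ₂ contain two subgroups each, and the
remaining 19 conjugacy classes each contain a single subgroup. -/
theorem whittenGroup_two_normal_subgroups :
    Nat.card {H : Subgroup (WhittenGroup 2) // H.Normal} = 19 ∧
    Nat.card {q : Quot (subgroupConj (G := WhittenGroup 2)) //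
      Nat.card {H : Subgroup (WhittenGroup 2) // Quot.mk subgroupConj H = q} = 2} = 8 ∧
    Nat.card {q : Quot (subgroupConj (G := WhittenGroup 2)) //
      Nat.card {H : Subgroup (WhittenGroup 2) // Quot.mk subgroupConj H = q} = 1} = 19 := by
  have : Finite (Subgroup (WhittenGroup 2)) :=
    Nat.finite_of_card_ne_zero (by rw [card_subgroup_whittenGroup_two]; lia)
  have h₁ := card_singleton_conjClasses (WhittenGroup 2)
  rw [card_normal_subgroup_whittenGroup_two] at h₁
  have h := Nat.card_eq_add_two_mul_of_card_fiber (Quot.mk (subgroupConj (G := WhittenGroup 2)))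
    card_conjClass_eq_one_or_two
  rw [card_subgroup_whittenGroup_two, h₁] at h
  exact ⟨card_normal_subgroup_whittenGroup_two, by lia, h₁⟩
end
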